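/- arXiv:1205.3235 — 4 statements merged into one kernel-verified Lean document; each statement's English description precedes it below -/
import Mathlib

section
/- Let (X,d) be a separable metric space with a Borel measure μ, let (V,‖·‖) be a real normed vector space, and let V_1,…,V_M : X → V be Borel maps such that each function x ↦ ‖V_i(x)‖ is μ-essentially bounded. Let A ⊆ X be measurable with μ(A) > 0 and suppose that for every x ∈ A the real linear span of V_1(x),…,V_M(x) has dimension exactly M−1. Then there exist measurable functions λ_1,…,λ_M : A → ℝ with |λ_i(x)| ≤ 1 for all x ∈ A, such that Σ_{i=1}^M λ_i(x)·V_i(x) = 0 for μ-a.e. x ∈ A, and μ({x ∈ A : λ_i(x) = 0 for all i = 1,…,M}) = 0. Moreover, if in addition for every x ∈ A the span of V_1(x),…,V_M(x) equals the span of V_1(x),…,V_{M−1}(x), then λ_M(x) ≠ 0 for μ-a.e. x ∈ A. -/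
open MeasureTheory Metric Filter Set Topology
open scoped ENNReal NNReal

noncomputable section

/-- `f` is a bounded Lipschitz function. -/
def IsBddLipschitz {X : Type*} [PseudoMetricSpace X] (f : X → ℝ) : Prop :=
  (∃ K : ℝ≥0, LipschitzWith K f) ∧ ∃ M : ℝ, ∀ x, |f x| ≤ M

/-- The global Lipschitz constant of `f`. -/
def glip {X : Type*} [PseudoMetricSpace X] (f : X → ℝ) : ℝ :=
  sInf {K : ℝ | 0 ≤ K ∧ ∀ x y, |f x - f y| ≤ K * dist x y}

/-- `max (sup_X |f|) (global Lipschitz constant of f)`. -/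
def lipNorm {X : Type*} [PseudoMetricSpace X] (f : X → ℝ) : ℝ :=
  max (⨆ x, |f x|) (glip f)

/-- The variation of `f` on the open ball `B(x,r)`:
`varlip f x r = r⁻¹ · sup_{y ∈ B(x,r)} |f x - f y|`. -/
def varlip {X : Type*} [PseudoMetricSpace X] (f : X → ℝ) (x : X) (r : ℝ) : ℝ :=
  r⁻¹ * sSup ((fun y => |f x - f y|) '' ball x r)

/-- The upper variation of `f` at `x` from scale `r` down to `0`:
`Lip f (x,r) = sup_{0 < s ≤ r} varlip f x s`. -/
def bigLipR {X : Type*} [PseudoMetricSpace X] (f : X → ℝ) (x : X) (r : ℝ) : ℝ :=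
  ⨆ s : Ioc (0:ℝ) r, varlip f x s.1

/-- The lower variation of `f` at `x` from scale `r` down to `0`:
`lip f (x,r) = inf_{0 < s ≤ r} varlip f x s`. -/
def smlLipR {X : Type*} [PseudoMetricSpace X] (f : X → ℝ) (x : X) (r : ℝ) : ℝ :=
  ⨅ s : Ioc (0:ℝ) r, varlip f x s.1

/-- The pointwise upper Lipschitz constant
`Lip f (x) = inf_{r>0} sup_{0<s≤r} varlip f x s`. -/
def bigLip {X : Type*} [PseudoMetricSpace X] (f : X → ℝ) (x : X) : ℝ :=
  ⨅ r : Ioi (0:ℝ), bigLipR f x r.1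

/-- The pointwise lower Lipschitz constant
`lip f (x) = sup_{r>0} inf_{0<s≤r} varlip f x s`. -/
def smlLip {X : Type*} [PseudoMetricSpace X] (f : X → ℝ) (x : X) : ℝ :=
  ⨆ r : Ioi (0:ℝ), smlLipR f x r.1

/-- `BorelLevel b t s` says that `s` belongs to the level `t` of the Borel hierarchy generated by
the sequence `b`, where each step takes a countable union of complements. -/
inductive BorelLevel {Ω T : Type*} [LT T] (b : ℕ → Set Ω) : T → Set Ω → Prop
  | basic (t : T) (n : ℕ) : BorelLevel b t (b n)
  | iUnion_compl (t : T) (s : ℕ → Set Ω) (j : ℕ → T) (hj : ∀ n, j n < t)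
      (hs : ∀ n, BorelLevel b (j n) (s n)) : BorelLevel b t (⋃ n, (s n)ᶜ)

namespace BorelLevel

variable {Ω T : Type*} {b : ℕ → Set Ω}

lemma mono [Preorder T] {t t' : T} (h : t ≤ t') {s : Set Ω} (hs : BorelLevel b t s) :
    BorelLevel b t' s := by
  cases hs with
  | basic _ n => exact basic t' n
  | iUnion_compl _ s j hj hs => exact iUnion_compl t' s j (fun n => (hj n).trans_le h) hs

lemma compl [Preorder T] {t t' : T} (h : t < t') {s : Set Ω} (hs : BorelLevel b t s) :
    BorelLevel b t' sᶜ := by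
  simpa only [iUnion_const] using iUnion_compl t' (fun _ => s) (fun _ => t) (fun _ => h)
    (fun _ => hs)

/-- A family of sets of the same level is jointly measurable in the point and the index. -/
lemma measurableSet_prod [LinearOrder T] [WellFoundedLT T] (hT : ∀ t : T, (Iio t).Countable)
    [MeasurableSpace Ω] (hb : ∀ n, MeasurableSet (b n))
    {I : Type*} [MeasurableSpace I] [DiscreteMeasurableSpace I] (t : T) (F : I → Set Ω)
    (hF : ∀ i, BorelLevel b t (F i)) : MeasurableSet {p : Ω × I | p.1 ∈ F p.2} := by
  classical
  induction t using WellFoundedLT.induction generalizing F with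
  | ind t ih =>
    have key : ∀ i, (∃ n, F i = b n) ∨ ∃ (s : ℕ → Set Ω) (j : ℕ → T), (∀ n, j n < t) ∧
        (∀ n, BorelLevel b (j n) (s n)) ∧ F i = ⋃ n, (s n)ᶜ := by
      intro i
      generalize hA : F i = A
      have hA' : BorelLevel b t A := hA ▸ hF i
      clear hA
      cases hA' with
      | basic _ n => exact .inl ⟨n, rfl⟩
      | iUnion_compl _ s j hj hs => exact .inr ⟨s, j, hj, hs, rfl⟩
    let P : Set I := {i | ∃ n, F i = b n}
    have hP : ∀ i, i ∈ Pᶜ → ∃ (s : ℕ → Set Ω) (j : ℕ → T), (∀ n, j n < t) ∧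
        (∀ n, BorelLevel b (j n) (s n)) ∧ F i = ⋃ n, (s n)ᶜ :=
      fun i hi => (key i).resolve_left hi
    have : Nonempty T := ⟨t⟩
    choose! s j hj hs hsF using hP
    have eq : {p : Ω × I | p.1 ∈ F p.2} =
        (⋃ n, b n ×ˢ {i | F i = b n}) ∪ ((univ ×ˢ Pᶜ) ∩ ⋃ m, ⋃ l ∈ Iio t,
          (univ ×ˢ {i | i ∈ Pᶜ ∧ j i m = l}) ∩
            {p : Ω × I | p.1 ∈ if p.2 ∈ Pᶜ ∧ j p.2 m = l then s p.2 m else b 0}ᶜ) := by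
      ext ⟨ω, i⟩
      by_cases hi : i ∈ P
      · obtain ⟨n, hn⟩ := id hi
        simp only [mem_ofPred_eq, mem_union, mem_iUnion, mem_prod, mem_inter_iff, mem_compl_iff, hi]
        constructor
        · exact fun h => .inl ⟨n, hn ▸ h, hn⟩
        · rintro (⟨m, h, hm⟩ | h)
          · exact hm ▸ h
          · simp at h
      · have hi' : i ∈ Pᶜ := hi
        have hn : ∀ n, F i ≠ b n := fun n hn => hi ⟨n, hn⟩
        simp only [mem_ofPred_eq, mem_union, mem_iUnion, mem_prod, mem_inter_iff, mem_compl_iff,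
          hn, and_false, exists_false, false_or, hi, not_false_eq_true, true_and, and_true,
          mem_univ, mem_Iio]
        rw [hsF i hi']
        simp only [mem_iUnion, mem_compl_iff]
        constructor
        · rintro ⟨m, hm⟩
          exact ⟨m, j i m, hj i hi' m, rfl, by simpa using hm⟩
        · rintro ⟨m, l, -, rfl, hm⟩
          exact ⟨m, by simpa using hm⟩
    rw [eq]
    refine (MeasurableSet.iUnion fun n => (hb n).prod .of_discrete).union
      ((MeasurableSet.univ.prod .of_discrete).inter (MeasurableSet.iUnion fun m =>
        MeasurableSet.biUnion (hT t) fun l hl => (MeasurableSet.univ.prod .of_discrete).inter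
          (MeasurableSet.compl (ih l hl
            (fun i => if i ∈ Pᶜ ∧ j i m = l then s i m else b 0) fun i => ?_))))
    split_ifs with h
    · exact h.2 ▸ hs i h.1 m
    · exact basic l 0

variable [LinearOrder T]

lemma exists_iUnion (hT : ∀ j : ℕ → T, ∃ t, ∀ n, j n < t) {I : Type*} {F : ℕ → I → Set Ω}
    (hF : ∀ n, ∃ t : T, ∀ i, BorelLevel b t (F n i)) :
    ∃ t : T, ∀ i, BorelLevel b t (⋃ n, F n i) := by
  choose j hj using hF
  obtain ⟨t, ht⟩ := hT j
  obtain ⟨t', ht'⟩ := hT fun _ => t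
  refine ⟨t', fun i => ?_⟩
  simpa only [compl_compl] using
    iUnion_compl t' (fun n => (F n i)ᶜ) (fun _ => t) ht' fun n => (hj n i).compl (ht n)

lemma exists_compl (hT : ∀ j : ℕ → T, ∃ t, ∀ n, j n < t) {I : Type*} {F : I → Set Ω}
    (hF : ∃ t : T, ∀ i, BorelLevel b t (F i)) :
    ∃ t : T, ∀ i, BorelLevel b t (F i)ᶜ := by
  obtain ⟨t, ht⟩ := hF
  obtain ⟨t', ht'⟩ := hT fun _ => t
  exact ⟨t', fun i => (ht i).compl (ht' 0)⟩

lemma exists_of_measurableSet [m : MeasurableSpace Ω] [Nonempty T]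
    (hT : ∀ j : ℕ → T, ∃ t, ∀ n, j n < t)
    (hb0 : ∅ ∈ range b) (hb : MeasurableSpace.generateFrom (range b) = m) {A : Set Ω}
    (hA : MeasurableSet A) : ∃ t : T, BorelLevel b t A := by
  obtain ⟨t₀⟩ := ‹Nonempty T›
  rw [← hb] at hA
  induction A, hA using MeasurableSpace.generateFrom_induction with
  | hC A hA _ =>
    obtain ⟨n, rfl⟩ := hA
    exact ⟨t₀, basic t₀ n⟩
  | empty =>
    obtain ⟨n, hn⟩ := hb0
    exact ⟨t₀, hn ▸ basic t₀ n⟩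
  | compl A _ ih =>
    obtain ⟨t, ht⟩ := ih
    obtain ⟨t', ht'⟩ := exists_compl hT (I := Unit) ⟨t, fun _ => ht⟩
    exact ⟨t', ht' ()⟩
  | iUnion A _ ih =>
    obtain ⟨t', ht'⟩ := exists_iUnion hT (I := Unit) (F := fun n _ => A n) fun n => by
      simpa using ih n
    exact ⟨t', ht' ()⟩

/-- The sections of a measurable subset of a product have bounded level. -/
lemma exists_of_measurableSet_prod [m : MeasurableSpace Ω] [Nonempty T]
    (hT : ∀ j : ℕ → T, ∃ t, ∀ n, j n < t)
    (hb0 : ∅ ∈ range b) (hb : MeasurableSpace.generateFrom (range b) = m)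
    {I : Type*} [MeasurableSpace I] {E : Set (Ω × I)} (hE : MeasurableSet E) :
    ∃ t : T, ∀ i, BorelLevel b t {ω | (ω, i) ∈ E} := by
  rw [← generateFrom_prod] at hE
  induction E, hE using MeasurableSpace.generateFrom_induction with
  | hC E hE _ =>
    obtain ⟨A, hA, S, -, rfl⟩ := hE
    obtain ⟨t, ht⟩ := exists_of_measurableSet hT hb0 hb hA
    obtain ⟨n, hn⟩ := hb0
    refine ⟨t, fun i => ?_⟩
    by_cases hi : i ∈ S
    · simpa [hi] using ht
    · simpa [hi, hn] using basic (b := b) t n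
  | empty =>
    obtain ⟨t₀⟩ := ‹Nonempty T›
    obtain ⟨n, hn⟩ := hb0
    exact ⟨t₀, fun i => by simpa [hn] using basic (b := b) t₀ n⟩
  | compl E _ ih => exact exists_compl hT ih
  | iUnion E _ ih =>
    simpa only [mem_iUnion, ofPred_exists] using exists_iUnion hT ih

end BorelLevel

section DiscreteMaps

variable {Ω : Type*} [MeasurableSpace Ω]

/-- In the presence of countable initial segments and an injection into `ℝ`, every relation is
jointly measurable. -/
lemma measurableSet_prod_of_countable_Iic {T : Type*} [LinearOrder T]
    (hT : ∀ t : T, (Iic t).Countable) [MeasurableSpace T] [DiscreteMeasurableSpace T]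
    {e : T → ℝ} (he : Function.Injective e) {f : Ω → T} (hf : Measurable f) (A : T → T → Prop) :
    MeasurableSet {p : Ω × T | A (f p.1) p.2} := by
  have henum : ∀ t : T, ∃ u : ℕ → T, Iic t = range u :=
    fun t => (hT t).exists_eq_range ⟨t, le_rfl⟩
  choose u hu using henum
  have hle : ∀ s t : T, s ≤ t → ∃ n, u t n = s := fun s t h => by
    have : s ∈ range (u t) := hu t ▸ h
    exact this
  have heq : ∀ {g h : Ω × T → T}, Measurable g → Measurable h → MeasurableSet {p | g p = h p} := by
    intro g h hg hh
    have := measurableSet_eq_fun ((Measurable.of_discrete (f := e)).comp hg)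
      ((Measurable.of_discrete (f := e)).comp hh)
    simpa only [Function.comp_apply, he.eq_iff] using this
  have hf1 : Measurable fun p : Ω × T => f p.1 := hf.comp measurable_fst
  have eq : {p : Ω × T | A (f p.1) p.2} =
      (⋃ n, {p | f p.1 = u p.2 n} ∩ Prod.snd ⁻¹' {t | A (u t n) t}) ∪
      (⋃ n, {p | u (f p.1) n = p.2} ∩ (fun p => f p.1) ⁻¹' {s | A s (u s n)}) := by
    ext ⟨ω, t⟩
    simp only [mem_ofPred_eq, mem_union, mem_iUnion, mem_inter_iff, mem_preimage]
    constructor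
    · intro h
      rcases le_total (f ω) t with hl | hl
      · obtain ⟨n, hn⟩ := hle _ _ hl
        exact .inl ⟨n, hn.symm, hn.symm ▸ h⟩
      · obtain ⟨n, hn⟩ := hle _ _ hl
        exact .inr ⟨n, hn, hn.symm ▸ h⟩
    · rintro (⟨n, hn, h⟩ | ⟨n, hn, h⟩)
      · exact hn ▸ h
      · exact hn ▸ h
  rw [eq]
  refine .union (.iUnion fun n => ?_) (.iUnion fun n => ?_)
  · exact (heq hf1 ((Measurable.of_discrete (f := fun t => u t n)).comp measurable_snd)).inter
      (measurable_snd .of_discrete)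
  · exact (heq ((Measurable.of_discrete (f := fun t => u t n)).comp hf1) measurable_snd).inter
      (hf1 .of_discrete)

/-- If every relation between the values of `f` and `T` is jointly measurable, where `T` indexes
the Borel hierarchy, then the preimages under `f` have bounded level. -/
lemma exists_borelLevel_preimage {b : ℕ → Set Ω} {T : Type*} [LinearOrder T] [Nonempty T]
    (hT : ∀ j : ℕ → T, ∃ t, ∀ n, j n < t) (hb0 : ∅ ∈ range b)
    (hb : MeasurableSpace.generateFrom (range b) = ‹MeasurableSpace Ω›)
    [MeasurableSpace T] {K : Type*} (f : Ω → K)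
    (hf : ∀ A : K → T → Prop, MeasurableSet {p : Ω × T | A (f p.1) p.2}) :
    ∃ t : T, ∀ S : Set K, BorelLevel b t (f ⁻¹' S) := by
  by_contra! h
  choose S hS using h
  obtain ⟨t, ht⟩ := BorelLevel.exists_of_measurableSet_prod hT hb0 hb (hf fun k t => k ∈ S t)
  exact hS t (ht t)

/-- A pair of maps which are measurable for the discrete σ-algebra is again such. -/
theorem measurableSet_prodMk_preimage_of_discrete [MeasurableSpace.CountablyGenerated Ω]
    {K L : Type*} {f : Ω → K} {g : Ω → L} (hf : ∀ S, MeasurableSet (f ⁻¹' S))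
    (hg : ∀ S, MeasurableSet (g ⁻¹' S)) (A : Set (K × L)) :
    MeasurableSet ((fun ω => (f ω, g ω)) ⁻¹' A) := by
  by_cases hc : (range f).Countable
  · have eq : (fun ω => (f ω, g ω)) ⁻¹' A =
        ⋃ k ∈ range f, f ⁻¹' {k} ∩ g ⁻¹' {l | (k, l) ∈ A} := by
      ext ω
      simp only [mem_preimage, mem_iUnion, mem_inter_iff, mem_singleton_iff, mem_ofPred_eq,
        exists_prop]
      exact ⟨fun h => ⟨f ω, mem_range_self ω, rfl, h⟩, fun ⟨k, _, hk, h⟩ => hk ▸ h⟩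
    rw [eq]
    exact .biUnion hc fun k _ => (hf _).inter (hg _)
  let T : Type := (Cardinal.aleph 1).ord.ToType
  have hTcard : Cardinal.mk T = Cardinal.aleph 1 := Cardinal.mk_ord_toType _
  have hIio : ∀ t : T, (Iio t).Countable := fun t => by
    rw [← Cardinal.le_aleph0_iff_set_countable, ← Cardinal.lt_aleph_one_iff]
    exact (Cardinal.mk_Iio_lt t (by simp [T])).trans_eq hTcard
  have hIic : ∀ t : T, (Iic t).Countable := fun t => by
    rw [← Iio_insert]
    exact (hIio t).insert t
  have hunc : ¬ (univ : Set T).Countable := by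
    rw [← Cardinal.le_aleph0_iff_set_countable, ← Cardinal.lt_aleph_one_iff, Cardinal.mk_univ,
      hTcard]
    exact lt_irrefl _
  have : Nonempty T := by
    by_contra h
    rw [not_nonempty_iff] at h
    exact hunc (to_countable _)
  have hT : ∀ j : ℕ → T, ∃ t, ∀ n, j n < t := by
    intro j
    by_contra! h
    refine hunc ((countable_iUnion fun n => hIic (j n)).mono fun t _ => ?_)
    simpa using h t
  obtain ⟨e, he⟩ : ∃ e : T → ℝ, Function.Injective e := by
    have : Cardinal.mk T ≤ Cardinal.mk ℝ := by
      rw [hTcard, Cardinal.mk_real]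
      exact Cardinal.aleph_one_le_continuum
    exact ⟨_, (Classical.choice this).injective⟩
  obtain ⟨σ, hσ⟩ : ∃ σ : T → Ω, Function.Injective (f ∘ σ) := by
    have hle : Cardinal.lift (Cardinal.mk T) ≤ Cardinal.lift (Cardinal.mk (range f)) := by
      by_contra! h
      rw [hTcard, Cardinal.lift_aleph, Ordinal.lift_one, Cardinal.lt_aleph_one_iff,
        Cardinal.lift_le_aleph0, Cardinal.le_aleph0_iff_set_countable] at h
      exact hc h
    obtain ⟨φ⟩ := Cardinal.lift_mk_le'.1 hle
    choose σ hσ using fun t => (φ t).2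
    refine ⟨σ, fun s t h => φ.injective (Subtype.ext ?_)⟩
    simpa [hσ] using h
  let r : K → T := Function.invFun (f ∘ σ)
  have hr : ∀ t, r (f (σ t)) = t := Function.leftInverse_invFun hσ
  let b := MeasurableSpace.natGeneratingSequence Ω
  have hb := MeasurableSpace.generateFrom_natGeneratingSequence Ω
  have hbm : ∀ n, MeasurableSet (b n) := MeasurableSpace.measurableSet_natGeneratingSequence
  have hb0 : ∅ ∈ range b := by
    simp only [b, MeasurableSpace.natGeneratingSequence]
    rw [range_enumerateCountable_of_mem _ MeasurableSpace.empty_mem_countableGeneratingSet]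
    exact MeasurableSpace.empty_mem_countableGeneratingSet
  let _ : MeasurableSpace T := ⊤
  let _ : MeasurableSpace K := ⊤
  let _ : MeasurableSpace L := ⊤
  have hfm : Measurable f := fun S _ => hf S
  have hgm : Measurable g := fun S _ => hg S
  have hrf : Measurable (r ∘ f) := (Measurable.of_discrete (f := r)).comp hfm
  obtain ⟨t₁, ht₁⟩ := exists_borelLevel_preimage hT hb0 hb (r ∘ f)
    (measurableSet_prod_of_countable_Iic hIic he hrf)
  have hKT : ∀ A : K → T → Prop, MeasurableSet {p : Ω × T | A (f p.1) p.2} := by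
    intro A
    have h1 : MeasurableSet {p : Ω × K | p.1 ∈ (r ∘ f) ⁻¹' {t | A p.2 t}} :=
      BorelLevel.measurableSet_prod hIio hbm t₁ (fun k => (r ∘ f) ⁻¹' {t | A k t}) fun k => ht₁ _
    have h2 : Measurable fun p : Ω × T => (σ p.2, f p.1) :=
      ((Measurable.of_discrete (f := σ)).comp measurable_snd).prodMk (hfm.comp measurable_fst)
    simpa [preimage, hr] using h2 h1
  obtain ⟨t₂, ht₂⟩ := exists_borelLevel_preimage hT hb0 hb f hKT
  exact (measurable_id.prodMk hgm)
    (BorelLevel.measurableSet_prod hIio hbm t₂ (fun l => f ⁻¹' {k | (k, l) ∈ A}) fun l => ht₂ _)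

end DiscreteMaps

section Addition

/-- Every metric space has arbitrarily fine approximations of the identity which are measurable
for the discrete σ-algebra on the target. -/
lemma exists_discrete_approx {V : Type*} [PseudoMetricSpace V] [MeasurableSpace V]
    [OpensMeasurableSpace V] {ε : ℝ} (hε : 0 < ε) :
    ∃ q : V → V, (∀ S, MeasurableSet (q ⁻¹' S)) ∧ ∀ v, dist v (q v) < ε := by
  have wf : WellFounded (WellOrderingRel (α := V)) := WellOrderingRel.isWellOrder.wf
  have hne : ∀ v : V, {w | dist v w < ε}.Nonempty := fun v => ⟨v, by simpa using hε⟩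
  let q : V → V := fun v => wf.min {w | dist v w < ε} (hne v)
  have hq : ∀ v, dist v (q v) < ε := fun v => wf.min_mem _ (hne v)
  have hmin : ∀ v w, WellOrderingRel w (q v) → ε ≤ dist v w := fun v w h => by
    by_contra! h'
    exact wf.not_lt_min {w | dist v w < ε} h' h
  refine ⟨q, fun S => ?_, hq⟩
  let C : ℕ → Set V := fun m => {v | q v ∈ S ∧ dist v (q v) ≤ ε - 1 / (m + 1)}
  have hC : q ⁻¹' S = ⋃ m, C m := by
    ext v
    simp only [mem_preimage, mem_iUnion, C, mem_ofPred_eq, exists_and_left]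
    refine ⟨fun h => ⟨h, ?_⟩, fun h => h.1⟩
    obtain ⟨m, hm⟩ := exists_nat_one_div_lt (sub_pos.2 (hq v))
    exact ⟨m, by linarith⟩
  have sep : ∀ m : ℕ, ∀ v ∈ C m, ∀ v' ∈ C m, dist v v' < 1 / (m + 1) → q v = q v' := by
    intro m v hv v' hv' hd
    rcases trichotomous_of WellOrderingRel (q v) (q v') with h | h | h
    · have h1 := hmin v' _ h
      have h2 := hv.2
      have h3 := dist_triangle v' v (q v)
      rw [dist_comm v' v] at h3
      linarith
    · exact h
    · have h1 := hmin v _ h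
      have h2 := hv'.2
      have h3 := dist_triangle v v' (q v')
      linarith
  have closed : ∀ m, IsClosed (C m) := by
    intro m
    refine isClosed_of_closure_subset fun v hv => ?_
    have hpos : (0 : ℝ) < 1 / (m + 1) := Nat.one_div_pos_of_nat
    obtain ⟨v₀, hv₀, hd₀⟩ := Metric.mem_closure_iff.1 hv (1 / (m + 1) / 2) (half_pos hpos)
    have near : ∀ δ > 0, ∃ v' ∈ C m, q v' = q v₀ ∧ dist v v' < δ := by
      intro δ hδ
      obtain ⟨v', hv', hd'⟩ := Metric.mem_closure_iff.1 hv (min δ (1 / (m + 1) / 2))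
        (lt_min hδ (half_pos hpos))
      refine ⟨v', hv', sep m v' hv' v₀ hv₀ ?_, hd'.trans_le (min_le_left _ _)⟩
      have h1 := dist_triangle_left v' v₀ v
      have h2 := hd'.trans_le (min_le_right _ _)
      linarith
    have hdist : dist v (q v₀) ≤ ε - 1 / (m + 1) := by
      refine le_of_forall_pos_lt_add fun δ hδ => ?_
      obtain ⟨v', hv', hqv', hd'⟩ := near δ hδ
      have h1 := dist_triangle v v' (q v₀)
      have h2 := hv'.2
      rw [hqv'] at h2
      linarith
    have hqv : q v = q v₀ := by
      rcases trichotomous_of WellOrderingRel (q v) (q v₀) with h | h | h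
      · exfalso
        obtain ⟨v', hv', hqv', hd'⟩ := near (ε - dist v (q v)) (sub_pos.2 (hq v))
        have h1 := hmin v' (q v) (hqv' ▸ h)
        have h2 := dist_triangle_left v' (q v) v
        linarith
      · exact h
      · have := hmin v _ h
        linarith
    exact ⟨hqv ▸ hv₀.1, hqv ▸ hdist⟩
  rw [hC]
  exact .iUnion fun m => (closed m).measurableSet

/-- On a countably generated measurable space, sums of Borel maps are Borel, without any
separability assumption on the target. -/
lemma Measurable.add_of_countablyGenerated {Ω V : Type*} [MeasurableSpace Ω]
    [MeasurableSpace.CountablyGenerated Ω] [NormedAddCommGroup V] [MeasurableSpace V]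
    [BorelSpace V] {f g : Ω → V} (hf : Measurable f) (hg : Measurable g) :
    Measurable fun ω => f ω + g ω := by
  choose q hq hqd using fun n : ℕ =>
    exists_discrete_approx (V := V) (Nat.one_div_pos_of_nat (α := ℝ) (n := n))
  have lim : ∀ v, Tendsto (fun n => q n v) atTop (𝓝 v) := fun v =>
    tendsto_iff_dist_tendsto_zero.2 (squeeze_zero (fun _ => dist_nonneg)
      (fun n => (dist_comm _ _).trans_le (hqd n v).le) tendsto_one_div_add_atTop_nhds_zero_nat)
  refine measurable_of_tendsto_metrizable (f := fun n ω => q n (f ω) + q n (g ω)) (fun n => ?_)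
    (tendsto_pi_nhds.2 fun ω => (lim _).add (lim _))
  intro S _
  exact measurableSet_prodMk_preimage_of_discrete (f := q n ∘ f) (g := q n ∘ g)
    (fun S => hf (hq n S)) (fun S => hg (hq n S)) {p | p.1 + p.2 ∈ S}

lemma measurable_sum_smul {Ω V ι : Type*} [MeasurableSpace Ω]
    [MeasurableSpace.CountablyGenerated Ω] [NormedAddCommGroup V] [NormedSpace ℝ V]
    [MeasurableSpace V] [BorelSpace V] {f : ι → Ω → V} (hf : ∀ i, Measurable (f i))
    (s : Finset ι) (a : ι → ℝ) : Measurable fun ω => ∑ i ∈ s, a i • f i ω := by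
  classical
  induction s using Finset.induction_on with
  | empty => simp
  | insert i s hi ih =>
    simp only [Finset.sum_insert hi]
    exact ((continuous_const_smul (a i)).measurable.comp (hf i)).add_of_countablyGenerated ih

end Addition

section Selection

variable {Ω V ι : Type*} [MeasurableSpace Ω] [MeasurableSpace.CountablyGenerated Ω]
  [NormedAddCommGroup V] [NormedSpace ℝ V] [MeasurableSpace V] [BorelSpace V] [Fintype ι]

/-- The set of points at which a compact set of coefficients contains a linear relation is
measurable. -/
lemma measurableSet_exists_relation {f : ι → Ω → V} (hf : ∀ i, Measurable (f i))
    {C : Set (ι → ℝ)} (hC : IsCompact C) :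
    MeasurableSet {ω | ∃ a ∈ C, ∑ i, a i • f i ω = 0} := by
  obtain ⟨D, hDC, hD, hCD⟩ :=
    (TopologicalSpace.IsSeparable.of_separableSpace C).exists_countable_dense_subset
  have eq : {ω | ∃ a ∈ C, ∑ i, a i • f i ω = 0} =
      ⋂ n : ℕ, ⋃ a ∈ D, {ω | ‖∑ i, a i • f i ω‖ < 1 / (n + 1)} := by
    ext ω
    have hcont : Continuous fun a : ι → ℝ => ‖∑ i, a i • f i ω‖ := by fun_prop
    simp only [mem_ofPred_eq, mem_iInter, mem_iUnion, exists_prop]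
    constructor
    · rintro ⟨a, ha, h0⟩ n
      have hopen : IsOpen {a : ι → ℝ | ‖∑ i, a i • f i ω‖ < 1 / (n + 1)} :=
        isOpen_lt hcont continuous_const
      obtain ⟨a', ha', haD⟩ := mem_closure_iff.1 (hCD ha) _ hopen
        (by simpa [h0] using Nat.cast_add_one_pos n)
      exact ⟨a', haD, ha'⟩
    · intro h
      have hne : C.Nonempty := by
        obtain ⟨a, ha, -⟩ := h 0
        exact ⟨a, hDC ha⟩
      obtain ⟨a, ha, hmin⟩ := hC.exists_isMinOn hne hcont.continuousOn
      refine ⟨a, ha, norm_le_zero_iff.1 (le_of_forall_pos_lt_add fun δ hδ => ?_)⟩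
      obtain ⟨n, hn⟩ := exists_nat_one_div_lt hδ
      obtain ⟨a', ha', h'⟩ := h n
      rw [zero_add]
      exact (hmin (hDC ha')).trans_lt (h'.trans hn)
  rw [eq]
  exact .iInter fun n => .biUnion hD fun a _ =>
    measurableSet_lt (measurable_sum_smul hf _ a).norm measurable_const

/-- If the relations between Borel maps form a line at every point of a measurable set `A`, then a
nonzero relation can be selected measurably. -/
lemma exists_measurable_relation [LinearOrder ι] {f : ι → Ω → V} (hf : ∀ i, Measurable (f i))
    {A : Set Ω} (hA : MeasurableSet A)
    (hker : ∀ ω ∈ A, Module.finrank ℝ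
      (LinearMap.ker (Fintype.linearCombination ℝ fun i => f i ω)) = 1) :
    ∃ lam : ι → Ω → ℝ, (∀ i, Measurable (lam i)) ∧ ∀ ω ∈ A,
      (∀ i, |lam i ω| ≤ 1) ∧ ∑ i, lam i ω • f i ω = 0 ∧ ∃ i, lam i ω ≠ 0 := by
  classical
  have unit : ∀ ω, ω ∈ A → ∃ a : ι → ℝ, ‖a‖ = 1 ∧ ∑ i, a i • f i ω = 0 ∧
      ∀ a' : ι → ℝ, ‖a'‖ = 1 → ∑ i, a' i • f i ω = 0 → a' = a ∨ a' = -a := by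
    intro ω hω
    obtain ⟨v, hv, hspan⟩ := finrank_eq_one_iff'.1 (hker ω hω)
    have hv' : (v : ι → ℝ) ≠ 0 := by simpa using hv
    have hv0 : ∑ i, (v : ι → ℝ) i • f i ω = 0 := by
      have h := LinearMap.mem_ker.1 v.2
      rwa [Fintype.linearCombination_apply] at h
    have hn : ‖(v : ι → ℝ)‖ ≠ 0 := norm_ne_zero_iff.2 hv'
    refine ⟨‖(v : ι → ℝ)‖⁻¹ • (v : ι → ℝ), ?_, ?_, fun a' ha' h0 => ?_⟩
    · rw [norm_smul, norm_inv, norm_norm, inv_mul_cancel₀ hn]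
    · simp only [Pi.smul_apply, smul_assoc, ← Finset.smul_sum, hv0, smul_zero]
    · obtain ⟨c, hc⟩ := hspan ⟨a', by simpa [Fintype.linearCombination_apply] using h0⟩
      have hc' : c • (v : ι → ℝ) = a' := congrArg Subtype.val hc
      have hcn : |c| = ‖(v : ι → ℝ)‖⁻¹ := by
        rw [← hc', norm_smul, Real.norm_eq_abs] at ha'
        exact eq_inv_of_mul_eq_one_left ha'
      rw [← hcn, ← hc']
      rcases abs_choice c with h | h <;> rw [h] <;> simp
  choose! u hu1 hu0 huniq using unit
  let P : ι → ι → Ω → ℝ := fun i j ω => if ω ∈ A then u ω i * u ω j else 0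
  have hP : ∀ i j, Measurable (P i j) := by
    intro i j
    refine measurable_of_Iic fun r => ?_
    have hcomp : IsCompact (sphere (0 : ι → ℝ) 1 ∩ {a | a i * a j ≤ r}) :=
      (isCompact_sphere _ _).inter_right (isClosed_le (by fun_prop) continuous_const)
    have eq : P i j ⁻¹' Iic r =
        (A ∩ {ω | ∃ a ∈ sphere (0 : ι → ℝ) 1 ∩ {a | a i * a j ≤ r}, ∑ i, a i • f i ω = 0}) ∪
          (Aᶜ ∩ {_ω | 0 ≤ r}) := by
      ext ω
      by_cases hω : ω ∈ A
      · simp only [P, mem_preimage, hω, if_true, mem_Iic, mem_union, mem_inter_iff, true_and,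
          mem_compl_iff, not_true, false_and, or_false, mem_ofPred_eq, mem_sphere_zero_iff_norm]
        refine ⟨fun h => ⟨u ω, ⟨hu1 ω hω, h⟩, hu0 ω hω⟩, ?_⟩
        rintro ⟨a, ⟨ha1, har⟩, ha0⟩
        rcases huniq ω hω a ha1 ha0 with rfl | rfl
        · exact har
        · simpa using har
      · simp [P, hω]
    rw [eq]
    exact (hA.inter (measurableSet_exists_relation hf hcomp)).union (hA.compl.inter (.const _))
  let Q : ι → Set Ω := fun k => {ω | P k k ω ≠ 0 ∧ ∀ j, j < k → P j j ω = 0}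
  have hQ : ∀ k, MeasurableSet (Q k) := fun k =>
    ((hP k k) (measurableSet_singleton 0).compl).inter
      (show MeasurableSet {ω | ∀ j, j < k → P j j ω = 0} by
        simp only [ofPred_forall]
        exact .iInter fun j => .iInter fun _ => (hP j j) (measurableSet_singleton 0))
  refine ⟨fun i ω => ∑ k, (Q k).indicator (P k i) ω,
    fun i => Finset.measurable_sum _ fun k _ => (hP k i).indicator (hQ k), fun ω hω => ?_⟩
  have hPu : ∀ i j, P i j ω = u ω i * u ω j := fun i j => if_pos hω
  obtain ⟨k, hk, hkmin⟩ : ∃ k, u ω k ≠ 0 ∧ ∀ j, j < k → u ω j = 0 := by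
    have hne : (Finset.univ.filter fun k => u ω k ≠ 0).Nonempty := by
      by_contra h
      have hz : u ω = 0 := by
        ext i
        by_contra hi
        exact h ⟨i, by simpa using hi⟩
      simpa [hz] using hu1 ω hω
    refine ⟨_, (Finset.mem_filter.1 (Finset.min'_mem _ hne)).2, fun j hj => ?_⟩
    by_contra hj'
    exact (Finset.min'_le _ j (by simpa using hj')).not_gt hj
  have hlam : ∀ i, ∑ l, (Q l).indicator (P l i) ω = u ω k * u ω i := by
    intro i
    rw [Finset.sum_eq_single k]
    · rw [indicator_of_mem, hPu]
      refine ⟨?_, fun j hj => ?_⟩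
      · simpa [hPu] using hk
      · simp [hPu, hkmin j hj]
    · intro l _ hl
      refine indicator_of_notMem (fun hlQ => ?_) _
      rcases lt_or_gt_of_ne hl with h | h
      · exact hlQ.1 (by simp [hPu, hkmin l h])
      · exact hk (by simpa [hPu] using hlQ.2 k h)
    · simp
  simp only [hlam]
  have hle : ∀ i, |u ω i| ≤ 1 := fun i => (norm_le_pi_norm (u ω) i).trans (hu1 ω hω).le
  refine ⟨fun i => ?_, ?_, k, mul_ne_zero hk hk⟩
  · rw [abs_mul]
    exact mul_le_one₀ (hle k) (abs_nonneg _) (hle i)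
  · simp only [mul_smul, ← Finset.smul_sum, hu0 ω hω, smul_zero]

end Selection

/-- If the first `m` of `m + 1` vectors span an `m`-dimensional space, then every nonzero relation
involves the last vector. -/
lemma last_ne_zero_of_relation {V : Type*} [AddCommGroup V] [Module ℝ V] {m : ℕ}
    {v : Fin (m + 1) → V} {a : Fin (m + 1) → ℝ}
    (hfin : Module.finrank ℝ (Submodule.span ℝ (v '' {i | (i : ℕ) < m})) = m)
    (h0 : ∑ i, a i • v i = 0) (ha : ∃ i, a i ≠ 0) : a (Fin.last m) ≠ 0 := by
  intro hlast
  have himg : v '' {i | (i : ℕ) < m} = range fun i : Fin m => v i.castSucc := by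
    ext w
    constructor
    · rintro ⟨i, hi, rfl⟩
      exact ⟨⟨i, hi⟩, rfl⟩
    · rintro ⟨i, rfl⟩
      exact ⟨i.castSucc, i.2, rfl⟩
  have hli : LinearIndependent ℝ fun i : Fin m => v i.castSucc := by
    rw [linearIndependent_iff_card_eq_finrank_span, Set.finrank, ← himg, hfin, Fintype.card_fin]
  rw [Fin.sum_univ_castSucc, hlast, zero_smul, add_zero] at h0
  have hz := Fintype.linearIndependent_iff.1 hli (fun i => a i.castSucc) h0
  obtain ⟨i, hi⟩ := ha
  induction i using Fin.lastCases with
  | last => exact hi hlast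
  | cast i => exact hi (hz i)

theorem stmt_0 {X V : Type*} [MetricSpace X] [TopologicalSpace.SeparableSpace X]
    [MeasurableSpace X] [BorelSpace X]
    [NormedAddCommGroup V] [NormedSpace ℝ V] [MeasurableSpace V] [BorelSpace V]
    (μ : Measure X) {M : ℕ} (hM : 0 < M) (Vs : Fin M → X → V)
    (hVmeas : ∀ i, Measurable (Vs i))
    (hVbdd : ∀ i, ∃ B : ℝ, ∀ᵐ x ∂μ, ‖Vs i x‖ ≤ B)
    (A : Set X) (hA : MeasurableSet A) (hApos : 0 < μ A)
    (hdim : ∀ x ∈ A,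
      Module.finrank ℝ (Submodule.span ℝ (Set.range fun i => Vs i x)) = M - 1) :
    ∃ lam : Fin M → X → ℝ,
      (∀ i, Measurable (lam i)) ∧
      (∀ i, ∀ x ∈ A, |lam i x| ≤ 1) ∧
      (∀ᵐ x ∂μ.restrict A, (∑ i, lam i x • Vs i x) = 0) ∧
      μ {x | x ∈ A ∧ ∀ i, lam i x = 0} = 0 ∧
      ((∀ x ∈ A, Submodule.span ℝ (Set.range fun i => Vs i x) =
          Submodule.span ℝ ((fun i => Vs i x) '' {i : Fin M | (i : ℕ) < M - 1})) →
        ∀ᵐ x ∂μ.restrict A, lam ⟨M - 1, Nat.sub_lt hM Nat.one_pos⟩ x ≠ 0) := by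
  
  have : SecondCountableTopology X := UniformSpace.secondCountable_of_separable X
  have hker : ∀ x ∈ A, Module.finrank ℝ
      (LinearMap.ker (Fintype.linearCombination ℝ fun i => Vs i x)) = 1 := by
    intro x hx
    have h := LinearMap.finrank_range_add_finrank_ker
      (Fintype.linearCombination ℝ fun i => Vs i x)
    rw [Fintype.range_linearCombination, hdim x hx, Module.finrank_fin_fun] at h
    omega
  obtain ⟨lam, hmeas, hlam⟩ := exists_measurable_relation hVmeas hA hker
  refine ⟨lam, hmeas, fun i x hx => (hlam x hx).1 i, ?_, ?_, fun hspan => ?_⟩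
  · exact (ae_restrict_iff' hA).2 (.of_forall fun x hx => (hlam x hx).2.1)
  · have hempty : {x | x ∈ A ∧ ∀ i, lam i x = 0} = ∅ := by
      refine eq_empty_of_forall_notMem fun x hx => ?_
      obtain ⟨i, hi⟩ := (hlam x hx.1).2.2
      exact hi (hx.2 i)
    rw [hempty, measure_empty]
  · refine (ae_restrict_iff' hA).2 (.of_forall fun x hx => ?_)
    obtain ⟨m, rfl⟩ : ∃ m, M = m + 1 := ⟨M - 1, by omega⟩
    exact last_ne_zero_of_relation (v := fun i => Vs i x) (a := fun i => lam i x)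
      ((congrArg (fun S : Submodule ℝ V => Module.finrank ℝ S) (hspan x hx)).symm.trans
        (hdim x hx)) (hlam x hx).2.1 (hlam x hx).2.2
end
end

section
/- Let (X,d) be a metric space and f : X → ℝ a Lipschitz function. Then the pointwise upper Lipschitz constant Lip f and the pointwise lower Lipschitz constant lip f are Borel measurable functions on X. -/
open MeasureTheory Metric Filter Set Topology
open scoped ENNReal NNReal

noncomputable section

section VarlipBounds

variable {X : Type*} [PseudoMetricSpace X] {f : X → ℝ} {K : ℝ≥0}

theorem LipschitzWith.abs_sub_le_mul_of_mem_ball (hf : LipschitzWith K f) {x y : X} {r : ℝ}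
    (hy : y ∈ ball x r) : |f x - f y| ≤ K * r := by
  rw [← Real.dist_eq]
  refine (hf.dist_le_mul x y).trans ?_
  rw [dist_comm]
  exact mul_le_mul_of_nonneg_left (mem_ball.1 hy).le K.2

theorem LipschitzWith.bddAbove_abs_sub_image_ball (hf : LipschitzWith K f) (x : X) (r : ℝ) :
    BddAbove ((fun y => |f x - f y|) '' ball x r) :=
  ⟨K * r, by rintro _ ⟨y, hy, rfl⟩; exact hf.abs_sub_le_mul_of_mem_ball hy⟩

theorem sSup_abs_sub_image_ball_nonneg (f : X → ℝ) (x : X) (r : ℝ) :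
    0 ≤ sSup ((fun y => |f x - f y|) '' ball x r) :=
  Real.sSup_nonneg (by rintro _ ⟨y, -, rfl⟩; exact abs_nonneg _)

theorem varlip_nonneg (f : X → ℝ) (x : X) {r : ℝ} (hr : 0 < r) : 0 ≤ varlip f x r :=
  mul_nonneg (inv_nonneg.2 hr.le) (sSup_abs_sub_image_ball_nonneg f x r)

theorem LipschitzWith.varlip_le (hf : LipschitzWith K f) (x : X) {r : ℝ} (hr : 0 < r) :
    varlip f x r ≤ K := by
  unfold varlip
  rw [inv_mul_le_iff₀ hr, mul_comm]
  refine csSup_le ((nonempty_ball.2 hr).image _) ?_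
  rintro _ ⟨y, hy, rfl⟩
  exact hf.abs_sub_le_mul_of_mem_ball hy

theorem LipschitzWith.bddAbove_range_varlip (hf : LipschitzWith K f) (x : X) (r : ℝ) :
    BddAbove (range fun s : Ioc (0 : ℝ) r => varlip f x s.1) :=
  ⟨K, by rintro _ ⟨s, rfl⟩; exact hf.varlip_le x s.2.1⟩

theorem bddBelow_range_varlip (f : X → ℝ) (x : X) (r : ℝ) :
    BddBelow (range fun s : Ioc (0 : ℝ) r => varlip f x s.1) :=
  ⟨0, by rintro _ ⟨s, rfl⟩; exact varlip_nonneg f x s.2.1⟩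

theorem LipschitzWith.varlip_le_inv_mul (hf : LipschitzWith K f) (x : X) {q s : ℝ} (hq : 0 < q)
    (hqs : q ≤ s) : varlip f x q ≤ q⁻¹ * sSup ((fun y => |f x - f y|) '' ball x s) :=
  mul_le_mul_of_nonneg_left
    (csSup_le_csSup (hf.bddAbove_abs_sub_image_ball x s) ((nonempty_ball.2 hq).image _)
      (image_mono (ball_subset_ball hqs))) (inv_nonneg.2 hq.le)

theorem LipschitzWith.lowerSemicontinuous_varlip (hf : LipschitzWith K f) {r : ℝ} (hr : 0 < r) :
    LowerSemicontinuous fun x => varlip f x r := by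
  intro x a ha
  simp only [varlip, gt_iff_lt] at ha ⊢
  rw [← div_eq_inv_mul, lt_div_iff₀ hr] at ha
  obtain ⟨_, ⟨y, hy, rfl⟩, hlt⟩ := exists_lt_of_lt_csSup ((nonempty_ball.2 hr).image _) ha
  have hball : ∀ᶠ x' in 𝓝 x, dist y x' < r :=
    (continuous_const.dist continuous_id).continuousAt.eventually_lt_const (mem_ball.1 hy)
  have hval : ∀ᶠ x' in 𝓝 x, a * r < |f x' - f y| :=
    (hf.continuous.sub continuous_const).abs.continuousAt.eventually_const_lt hlt
  filter_upwards [hball, hval] with x' hx' hv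
  rw [← div_eq_inv_mul, lt_div_iff₀ hr]
  exact hv.trans_le (le_csSup (hf.bddAbove_abs_sub_image_ball x' r) ⟨y, hx', rfl⟩)

theorem LipschitzWith.lowerSemicontinuous_bigLipR (hf : LipschitzWith K f) (r : ℝ) :
    LowerSemicontinuous fun x => bigLipR f x r :=
  lowerSemicontinuous_ciSup (fun x => hf.bddAbove_range_varlip x r)
    fun s => hf.lowerSemicontinuous_varlip s.2.1

theorem LipschitzWith.smlLipR_eq_iInf_rat (hf : LipschitzWith K f) (x : X) {r : ℝ} (hr : 0 < r) :
    smlLipR f x r = ⨅ q : {q : ℚ // (q : ℝ) ∈ Ioc 0 r}, varlip f x q.1 := by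
  have : Nonempty (Ioc (0 : ℝ) r) := ⟨⟨r, hr, le_rfl⟩⟩
  have : Nonempty {q : ℚ // (q : ℝ) ∈ Ioc 0 r} := by
    obtain ⟨q, h0, h1⟩ := exists_rat_btwn hr
    exact ⟨⟨q, h0, h1.le⟩⟩
  apply le_antisymm
  · exact le_ciInf fun q => ciInf_le (bddBelow_range_varlip f x r) ⟨q.1, q.2⟩
  · refine le_ciInf fun ⟨s, hs0, hsr⟩ => le_of_forall_gt fun a ha => ?_
    have hcont : ContinuousAt (fun t : ℝ => t⁻¹ * sSup ((fun y => |f x - f y|) '' ball x s)) s :=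
      (continuousAt_inv₀ hs0.ne').mul continuousAt_const
    obtain ⟨l, hl, hlt⟩ := (mem_nhdsLE_iff_exists_Ioc_subset' hs0).1
      (mem_nhdsWithin_of_mem_nhds (hcont.eventually_lt_const ha))
    obtain ⟨q, hq1, hq2⟩ := exists_rat_btwn (max_lt hl hs0)
    have hq0 : (0 : ℝ) < q := (le_max_right _ _).trans_lt hq1
    refine (ciInf_le ⟨0, ?_⟩ (⟨q, hq0, hq2.le.trans hsr⟩ : {q : ℚ // (q : ℝ) ∈ Ioc 0 r})).trans_lt
      ((hf.varlip_le_inv_mul x hq0 hq2.le).trans_lt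
        (hlt ⟨(le_max_left _ _).trans_lt hq1, hq2.le⟩))
    rintro _ ⟨p, rfl⟩
    exact varlip_nonneg f x p.2.1

theorem LipschitzWith.measurable_smlLipR [MeasurableSpace X] [OpensMeasurableSpace X]
    (hf : LipschitzWith K f) {r : ℝ} (hr : 0 < r) : Measurable fun x => smlLipR f x r := by
  simp_rw [hf.smlLipR_eq_iInf_rat _ hr]
  exact Measurable.iInf fun q => (hf.lowerSemicontinuous_varlip q.2.1).measurable

theorem LipschitzWith.bigLip_eq_iInf_nat (hf : LipschitzWith K f) (x : X) :
    bigLip f x = ⨅ n : ℕ, bigLipR f x (1 / (n + 1)) := by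
  have hnonneg (r : ℝ) : 0 ≤ bigLipR f x r := Real.iSup_nonneg fun s => varlip_nonneg f x s.2.1
  apply le_antisymm
  · exact le_ciInf fun n => ciInf_le ⟨0, by rintro _ ⟨r, rfl⟩; exact hnonneg r⟩
      (⟨1 / (n + 1), mem_Ioi.2 Nat.one_div_pos_of_nat⟩ : Ioi (0 : ℝ))
  · refine le_ciInf fun ⟨r, hr⟩ => ?_
    obtain ⟨n, hn⟩ := exists_nat_one_div_lt (mem_Ioi.1 hr)
    refine (ciInf_le ⟨0, by rintro _ ⟨m, rfl⟩; exact hnonneg _⟩ n).trans ?_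
    have : Nonempty (Ioc (0 : ℝ) (1 / (n + 1))) := ⟨⟨_, Nat.one_div_pos_of_nat, le_rfl⟩⟩
    exact ciSup_le fun s =>
      le_ciSup (hf.bddAbove_range_varlip x r) ⟨s.1, s.2.1, s.2.2.trans hn.le⟩

theorem LipschitzWith.smlLip_eq_iSup_nat (hf : LipschitzWith K f) (x : X) :
    smlLip f x = ⨆ n : ℕ, smlLipR f x (1 / (n + 1)) := by
  have hle {r : ℝ} (hr : 0 < r) : smlLipR f x r ≤ K :=
    (ciInf_le (bddBelow_range_varlip f x r) ⟨r, hr, le_rfl⟩).trans (hf.varlip_le x hr)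
  apply le_antisymm
  · refine ciSup_le fun ⟨r, hr⟩ => ?_
    obtain ⟨n, hn⟩ := exists_nat_one_div_lt (mem_Ioi.1 hr)
    refine le_trans ?_
      (le_ciSup (f := fun n : ℕ => smlLipR f x (1 / (n + 1)))
        ⟨K, by rintro _ ⟨m, rfl⟩; exact hle Nat.one_div_pos_of_nat⟩ n)
    have : Nonempty (Ioc (0 : ℝ) (1 / (n + 1))) := ⟨⟨_, Nat.one_div_pos_of_nat, le_rfl⟩⟩
    exact le_ciInf fun s =>
      ciInf_le (bddBelow_range_varlip f x r) ⟨s.1, s.2.1, s.2.2.trans hn.le⟩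
  · exact ciSup_le fun n => le_ciSup (f := fun r : Ioi (0 : ℝ) => smlLipR f x r.1)
      ⟨K, by rintro _ ⟨r, rfl⟩; exact hle r.2⟩ ⟨1 / (n + 1), mem_Ioi.2 Nat.one_div_pos_of_nat⟩

end VarlipBounds

theorem stmt_2 {X : Type*} [MetricSpace X] [MeasurableSpace X] [BorelSpace X]
    (f : X → ℝ) {K : ℝ≥0} (hf : LipschitzWith K f) :
    Measurable (bigLip f) ∧ Measurable (smlLip f) := by
  constructor
  · rw [funext hf.bigLip_eq_iInf_nat]
    exact Measurable.iInf fun n => (hf.lowerSemicontinuous_bigLipR _).measurable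
  · rw [funext hf.smlLip_eq_iSup_nat]
    exact Measurable.iSup fun n => hf.measurable_smlLipR Nat.one_div_pos_of_nat
end
end

section
/- Let (X,d,μ) be a metric space with a σ-finite Borel measure and let D be a derivation on (X,d,μ). If A ⊆ X is measurable and f, g are bounded Lipschitz functions on X with f(x) = g(x) for all x ∈ A, then Df(x) = Dg(x) for μ-a.e. x ∈ A. -/
open MeasureTheory Metric Filter Set Topology
open scoped ENNReal NNReal

noncomputable section

/-- A derivation on the metric measure space `(X,d,μ)`: a linear, bounded operator
from bounded Lipschitz functions to measurable essentially bounded functions that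
satisfies the Leibniz rule and is weak* sequentially continuous. -/
structure MDerivation (X : Type*) [PseudoMetricSpace X] [MeasurableSpace X]
    (μ : MeasureTheory.Measure X) where
  D : (X → ℝ) → (X → ℝ)
  C : ℝ
  C_nonneg : 0 ≤ C
  measurable_D : ∀ f, IsBddLipschitz f → Measurable (D f)
  linear : ∀ (a b : ℝ) (f g : X → ℝ), IsBddLipschitz f → IsBddLipschitz g →
      ∀ᵐ x ∂μ, D (fun y => a * f y + b * g y) x = a * D f x + b * D g x
  bound : ∀ f, IsBddLipschitz f → ∀ᵐ x ∂μ, |D f x| ≤ C * lipNorm f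
  leibniz : ∀ f g, IsBddLipschitz f → IsBddLipschitz g →
      ∀ᵐ x ∂μ, D (fun y => f y * g y) x = f x * D g x + g x * D f x
  weakStar : ∀ (F : ℕ → X → ℝ) (f : X → ℝ), (∀ n, IsBddLipschitz (F n)) →
      IsBddLipschitz f → (∃ B : ℝ, ∀ n, lipNorm (F n) ≤ B) →
      (∀ x, Tendsto (fun n => F n x) atTop (𝓝 (f x))) →
      ∀ g : X → ℝ, Integrable g μ →
        Tendsto (fun n => ∫ x, D (F n) x * g x ∂μ) atTop (𝓝 (∫ x, D f x * g x ∂μ))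

theorem lipNorm_le {X : Type*} [PseudoMetricSpace X] {f : X → ℝ} {K : ℝ≥0} {M : ℝ}
    (hK : LipschitzWith K f) (hM₀ : 0 ≤ M) (hM : ∀ x, |f x| ≤ M) :
    lipNorm f ≤ max M K := by
  refine max_le_max (Real.iSup_le hM hM₀) (csInf_le ⟨0, fun _ h => h.1⟩ ⟨K.2, fun x y => ?_⟩)
  simpa [Real.dist_eq] using hK.dist_le_mul x y

namespace IsBddLipschitz

variable {X : Type*} [PseudoMetricSpace X] {f g : X → ℝ}

theorem sub (hf : IsBddLipschitz f) (hg : IsBddLipschitz g) :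
    IsBddLipschitz (fun x => f x - g x) := by
  obtain ⟨⟨K, hK⟩, M, hM⟩ := hf
  obtain ⟨⟨L, hL⟩, N, hN⟩ := hg
  exact ⟨⟨K + L, hK.sub hL⟩, M + N,
    fun x => (abs_sub _ _).trans (add_le_add (hM x) (hN x))⟩

theorem exists_nonneg_bound (hf : IsBddLipschitz f) : ∃ M : ℝ, 0 ≤ M ∧ ∀ x, |f x| ≤ M := by
  obtain ⟨-, M, hM⟩ := hf
  exact ⟨max M 0, le_max_right _ _, fun x => (hM x).trans (le_max_left _ _)⟩

end IsBddLipschitz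

/-- Soft thresholding of a real number at level `ε`. -/
def softThreshold (ε t : ℝ) : ℝ := t - max (-ε) (min ε t)

theorem lipschitzWith_softThreshold (ε : ℝ) : LipschitzWith 2 (softThreshold ε) := by
  have h := LipschitzWith.id.sub ((LipschitzWith.id (α := ℝ)).const_min ε |>.const_max (-ε))
  rwa [one_add_one_eq_two] at h

theorem softThreshold_zero {ε : ℝ} (hε : 0 ≤ ε) : softThreshold ε 0 = 0 := by
  simp [softThreshold, hε]

theorem softThreshold_eq_zero {ε t : ℝ} (ht : |t| ≤ ε) : softThreshold ε t = 0 := by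
  obtain ⟨h₁, h₂⟩ := abs_le.1 ht
  simp [softThreshold, h₁, h₂]

theorem abs_softThreshold_le {ε : ℝ} (hε : 0 ≤ ε) (t : ℝ) : |softThreshold ε t| ≤ 2 * |t| := by
  simpa [softThreshold_zero hε, Real.dist_eq] using (lipschitzWith_softThreshold ε).dist_le_mul t 0

theorem abs_softThreshold_sub_le {ε : ℝ} (hε : 0 ≤ ε) (t : ℝ) : |softThreshold ε t - t| ≤ ε := by
  rw [softThreshold, sub_sub_cancel_left, abs_neg, abs_le]
  exact ⟨le_max_left _ _, max_le (by linarith) (min_le_left _ _)⟩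

namespace MDerivation

variable {X : Type*} [PseudoMetricSpace X] [MeasurableSpace X] {μ : Measure X}

theorem ae_softThreshold_comp_eq_zero (D : MDerivation X μ) {h : X → ℝ} (hh : IsBddLipschitz h)
    {ε : ℝ} (hε : 0 < ε) :
    ∀ᵐ x ∂μ, h x = 0 → D.D (fun y => softThreshold ε (h y)) x = 0 := by
  obtain ⟨M, hM₀, hM⟩ := hh.exists_nonneg_bound
  obtain ⟨⟨K, hK⟩, -⟩ := hh
  have hT : IsBddLipschitz (fun y => softThreshold ε (h y)) :=
    ⟨⟨_, (lipschitzWith_softThreshold ε).comp hK⟩, 2 * M, fun x =>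
      (abs_softThreshold_le hε.le _).trans (by linarith [hM x])⟩
  -- A cutoff equal to `1` on `{ε ≤ |h|}` and vanishing on `{h = 0}`.
  have hψ : IsBddLipschitz (fun y => min 1 (ε⁻¹ * |h y|)) := by
    refine ⟨⟨_, LipschitzWith.const_min (Kf := Real.toNNReal ε⁻¹ * K)
      (LipschitzWith.of_dist_le_mul fun x y => ?_) 1⟩, 1, fun x => ?_⟩
    · have h₁ := hK.dist_le_mul x y
      have h₂ := abs_abs_sub_abs_le_abs_sub (h x) (h y)
      rw [Real.dist_eq] at h₁ ⊢
      rw [← mul_sub, abs_mul, abs_of_pos (inv_pos.2 hε), NNReal.coe_mul,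
        Real.coe_toNNReal _ (inv_pos.2 hε).le, mul_assoc]
      exact mul_le_mul_of_nonneg_left (h₂.trans h₁) (inv_pos.2 hε).le
    · rw [abs_of_nonneg (by positivity)]
      exact min_le_left _ _
  have hprod : (fun y => min 1 (ε⁻¹ * |h y|) * softThreshold ε (h y))
      = fun y => softThreshold ε (h y) := by
    funext y
    rcases le_total |h y| ε with hy | hy
    · simp [softThreshold_eq_zero hy]
    · have : 1 ≤ ε⁻¹ * |h y| := by
        rwa [inv_mul_eq_div, one_le_div hε]
      rw [min_eq_left this, one_mul]
  have hL := D.leibniz _ _ hψ hT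
  rw [hprod] at hL
  filter_upwards [hL] with x hx hx₀
  rw [hx]
  simp [hx₀, softThreshold_zero hε.le]

theorem ae_restrict_eq_zero [SigmaFinite μ] (D : MDerivation X μ) {A : Set X}
    (hA : MeasurableSet A) {h : X → ℝ} (hh : IsBddLipschitz h) (hA₀ : ∀ x ∈ A, h x = 0) :
    ∀ᵐ x ∂μ.restrict A, D.D h x = 0 := by
  obtain ⟨M, hM₀, hM⟩ := hh.exists_nonneg_bound
  obtain ⟨K, hK⟩ := hh.1
  have hε (n : ℕ) : (0 : ℝ) < 1 / ((n : ℝ) + 1) := Nat.one_div_pos_of_nat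
  let T (n : ℕ) (x : X) : ℝ := softThreshold (1 / ((n : ℝ) + 1)) (h x)
  have hTlip (n : ℕ) : LipschitzWith (2 * K) (T n) := (lipschitzWith_softThreshold _).comp hK
  have hTbdd (n : ℕ) (x : X) : |T n x| ≤ 2 * M :=
    (abs_softThreshold_le (hε n).le _).trans (by linarith [hM x])
  have hTlim (x : X) : Tendsto (fun n => T n x) atTop (𝓝 (h x)) :=
    tendsto_iff_dist_tendsto_zero.2 <| squeeze_zero (fun _ => dist_nonneg)
      (fun n => abs_softThreshold_sub_le (hε n).le (h x)) tendsto_one_div_add_atTop_nhds_zero_nat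
  refine ae_eq_zero_of_forall_setIntegral_eq_of_sigmaFinite (fun s hs hμs => ?_)
    (fun s hs hμs => ?_)
  · refine Measure.integrableOn_of_bounded (M := D.C * lipNorm h) hμs.ne
      (D.measurable_D h hh).aestronglyMeasurable ?_
    exact ae_restrict_of_ae (ae_restrict_of_ae (D.bound h hh))
  · have hsA : MeasurableSet (s ∩ A) := hs.inter hA
    rw [Measure.restrict_apply hs] at hμs
    have hk : Integrable ((s ∩ A).indicator (fun _ => (1 : ℝ))) μ :=
      (integrable_indicator_iff hsA).2 (integrableOn_const hμs.ne)
    have hlim := D.weakStar T h (fun n => ⟨⟨_, hTlip n⟩, _, hTbdd n⟩) hh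
      ⟨_, fun n => lipNorm_le (hTlip n) (by positivity) (hTbdd n)⟩ hTlim _ hk
    have hzero (n : ℕ) : ∫ x, D.D (T n) x * (s ∩ A).indicator (fun _ => (1 : ℝ)) x ∂μ = 0 := by
      refine integral_eq_zero_of_ae ?_
      filter_upwards [D.ae_softThreshold_comp_eq_zero hh (hε n)] with x hx
      by_cases hxs : x ∈ s ∩ A
      · have hTx : D.D (T n) x = 0 := hx (hA₀ x hxs.2)
        simp [hTx]
      · simp [indicator_of_notMem hxs]
    simp only [hzero] at hlim
    rw [Measure.restrict_restrict hs, ← integral_indicator hsA,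
      tendsto_nhds_unique tendsto_const_nhds hlim]
    refine integral_congr_ae (Eventually.of_forall fun x => ?_)
    by_cases hxs : x ∈ s ∩ A
    · simp [indicator_of_mem hxs]
    · simp [indicator_of_notMem hxs]

end MDerivation

theorem stmt_6 {X : Type*} [MetricSpace X] [MeasurableSpace X] [BorelSpace X]
    (μ : Measure X) [SigmaFinite μ] (D : MDerivation X μ)
    (A : Set X) (hA : MeasurableSet A) (f g : X → ℝ)
    (hf : IsBddLipschitz f) (hg : IsBddLipschitz g) (hfg : ∀ x ∈ A, f x = g x) :
    ∀ᵐ x ∂μ.restrict A, D.D f x = D.D g x := by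
  have hlin := D.linear 1 (-1) f g hf hg
  have hsub : (fun y => 1 * f y + -1 * g y) = fun y => f y - g y := by
    funext y
    ring
  rw [hsub] at hlin
  filter_upwards [D.ae_restrict_eq_zero hA (hf.sub hg) fun x hx => sub_eq_zero.2 (hfg x hx),
    ae_restrict_of_ae hlin] with x hx₀ hx
  linarith
end
end

section
/- Let (X,d,μ) be a metric space with a σ-finite Borel measure, let D_1,…,D_n be derivations on (X,d,μ) that are linearly independent over L∞(μ), and let {g_1,…,g_M} be a finite set of bounded Lipschitz functions that sequentially generates the bounded Lipschitz functions on X. Then for μ-a.e. x ∈ X the n row vectors (D_i g_1(x),…,D_i g_M(x)) ∈ ℝ^M, i = 1,…,n, are linearly independent over ℝ; in particular M ≥ n. -/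
open MeasureTheory Metric Filter Set Topology
open scoped ENNReal NNReal

noncomputable section

/-- The derivations `D_1,…,D_n` are linearly independent over `L∞(μ)`. -/
def LinIndepDer {X : Type*} [PseudoMetricSpace X] [MeasurableSpace X]
    (μ : MeasureTheory.Measure X) {n : ℕ} (Ds : Fin n → MDerivation X μ) : Prop :=
  ∀ lam : Fin n → X → ℝ, (∀ i, Measurable (lam i)) →
    (∀ i, ∃ M : ℝ, ∀ᵐ x ∂μ, |lam i x| ≤ M) →
    (∀ f, IsBddLipschitz f → ∀ᵐ x ∂μ, (∑ i, lam i x * (Ds i).D f x) = 0) →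
    ∀ i, ∀ᵐ x ∂μ, lam i x = 0

/-- `G` sequentially generates the bounded Lipschitz functions: every bounded
Lipschitz function is the pointwise limit of a sequence, with uniformly bounded
Lipschitz norms, from the unital `ℝ`-subalgebra generated by `G`. -/
def SeqGenerates {X : Type*} [PseudoMetricSpace X] (G : Set (X → ℝ)) : Prop :=
  ∀ f : X → ℝ, IsBddLipschitz f → ∃ p : ℕ → X → ℝ,
    (∀ k, p k ∈ Algebra.adjoin ℝ G) ∧ (∃ B : ℝ, ∀ k, lipNorm (p k) ≤ B) ∧
    ∀ x, Tendsto (fun k => p k x) atTop (𝓝 (f x))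

namespace IsBddLipschitz

variable {X : Type*} [PseudoMetricSpace X] {f g : X → ℝ}

theorem const (c : ℝ) : IsBddLipschitz (fun _ : X => c) :=
  ⟨⟨0, LipschitzWith.const c⟩, |c|, fun _ => le_rfl⟩

theorem add (hf : IsBddLipschitz f) (hg : IsBddLipschitz g) : IsBddLipschitz (f + g) := by
  obtain ⟨⟨K, hK⟩, a, ha⟩ := hf
  obtain ⟨⟨L, hL⟩, b, hb⟩ := hg
  exact ⟨⟨K + L, hK.add hL⟩, a + b, fun x => (abs_add_le _ _).trans (add_le_add (ha x) (hb x))⟩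

theorem mul (hf : IsBddLipschitz f) (hg : IsBddLipschitz g) : IsBddLipschitz (f * g) := by
  obtain ⟨⟨K, hK⟩, a, ha⟩ := hf
  obtain ⟨⟨L, hL⟩, b, hb⟩ := hg
  refine ⟨⟨Real.toNNReal (|a| * L + |b| * K), ?_⟩, |a| * |b|, fun x => ?_⟩
  · refine LipschitzWith.of_dist_le' fun x y => ?_
    have hfxy := hK.dist_le_mul x y
    have hgxy := hL.dist_le_mul x y
    rw [Real.dist_eq] at hfxy hgxy ⊢
    have hsplit : (f * g) x - (f * g) y = f x * (g x - g y) + g y * (f x - f y) := by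
      simp only [Pi.mul_apply]; ring
    calc |(f * g) x - (f * g) y| ≤ |f x| * |g x - g y| + |g y| * |f x - f y| := by
          rw [hsplit, ← abs_mul, ← abs_mul]; exact abs_add_le _ _
      _ ≤ |a| * (L * dist x y) + |b| * (K * dist x y) := by
          gcongr ?_ * ?_ + ?_ * ?_
          exacts [(ha x).trans (le_abs_self a), (hb y).trans (le_abs_self b)]
      _ = (|a| * L + |b| * K) * dist x y := by ring
  · rw [Pi.mul_apply, abs_mul]
    exact mul_le_mul ((ha x).trans (le_abs_self a)) ((hb x).trans (le_abs_self b))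
      (abs_nonneg _) (abs_nonneg _)

theorem of_mem_adjoin {G : Set (X → ℝ)} (hG : ∀ h ∈ G, IsBddLipschitz h)
    (hf : f ∈ Algebra.adjoin ℝ G) : IsBddLipschitz f := by
  induction hf using Algebra.adjoin_induction with
  | mem h hh => exact hG h hh
  | algebraMap r => exact const r
  | add _ _ _ _ h₁ h₂ => exact h₁.add h₂
  | mul _ _ _ _ h₁ h₂ => exact h₁.mul h₂

end IsBddLipschitz

namespace MDerivation

variable {X : Type*} [PseudoMetricSpace X] [MeasurableSpace X] {μ : Measure X}

theorem map_add (D : MDerivation X μ) {f g : X → ℝ} (hf : IsBddLipschitz f)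
    (hg : IsBddLipschitz g) : ∀ᵐ x ∂μ, D.D (f + g) x = D.D f x + D.D g x := by
  have h := D.linear 1 1 f g hf hg
  simp only [one_mul] at h
  exact h

theorem map_const (D : MDerivation X μ) (c : ℝ) : ∀ᵐ x ∂μ, D.D (fun _ => c) x = 0 := by
  have hone : IsBddLipschitz (fun _ : X => (1 : ℝ)) := .const 1
  have hleib := D.leibniz _ _ hone hone
  have hlin := D.linear c 0 _ _ hone hone
  simp only [mul_one, zero_mul, add_zero, one_mul] at hleib hlin
  filter_upwards [hleib, hlin] with x h₁ h₂
  rw [h₂, left_eq_add.mp h₁, mul_zero]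

/-- A combination of derivations that vanishes on a set of functions
vanishes on the algebra it generates. -/
theorem sum_mul_eq_zero_of_mem_adjoin {ι : Type*} [Fintype ι] (Ds : ι → MDerivation X μ)
    (lam : ι → X → ℝ) {G : Set (X → ℝ)} (hG : ∀ h ∈ G, IsBddLipschitz h)
    (hzero : ∀ h ∈ G, ∀ᵐ x ∂μ, ∑ i, lam i x * (Ds i).D h x = 0)
    {f : X → ℝ} (hf : f ∈ Algebra.adjoin ℝ G) :
    ∀ᵐ x ∂μ, ∑ i, lam i x * (Ds i).D f x = 0 := by
  induction hf using Algebra.adjoin_induction with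
  | mem h hh => exact hzero h hh
  | algebraMap r =>
    filter_upwards [ae_all_iff.mpr fun i => (Ds i).map_const r] with x hx
    exact Finset.sum_eq_zero fun i _ => mul_eq_zero_of_right _ (hx i)
  | add p q hp hq ihp ihq =>
    filter_upwards [ihp, ihq, ae_all_iff.mpr fun i =>
      (Ds i).map_add (.of_mem_adjoin hG hp) (.of_mem_adjoin hG hq)] with x h₁ h₂ h
    simp only [h, mul_add, Finset.sum_add_distrib, h₁, h₂, add_zero]
  | mul p q hp hq ihp ihq =>
    filter_upwards [ihp, ihq, ae_all_iff.mpr fun i =>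
      (Ds i).leibniz p q (.of_mem_adjoin hG hp) (.of_mem_adjoin hG hq)] with x h₁ h₂ h
    calc ∑ i, lam i x * (Ds i).D (p * q) x
        = ∑ i, (p x * (lam i x * (Ds i).D q x) + q x * (lam i x * (Ds i).D p x)) :=
          Finset.sum_congr rfl fun i _ => by
            rw [show (Ds i).D (p * q) x = _ from h i]; ring
      _ = 0 := by rw [Finset.sum_add_distrib, ← Finset.mul_sum, ← Finset.mul_sum, h₁, h₂]; simp

/-- A combination of derivations with bounded measurable coefficients that vanishes on a
sequentially generating set vanishes on every bounded Lipschitz function. -/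
theorem sum_mul_eq_zero_of_seqGenerates [SigmaFinite μ] {ι : Type*} [Fintype ι]
    (Ds : ι → MDerivation X μ) (lam : ι → X → ℝ) (hmeas : ∀ i, Measurable (lam i))
    {R : ℝ} (hR : ∀ i x, |lam i x| ≤ R) {G : Set (X → ℝ)} (hG : ∀ h ∈ G, IsBddLipschitz h)
    (hgen : SeqGenerates G) (hzero : ∀ h ∈ G, ∀ᵐ x ∂μ, ∑ i, lam i x * (Ds i).D h x = 0)
    {f : X → ℝ} (hf : IsBddLipschitz f) : ∀ᵐ x ∂μ, ∑ i, lam i x * (Ds i).D f x = 0 := by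
  obtain ⟨p, hp, hB, hlim⟩ := hgen f hf
  have hpL : ∀ k, IsBddLipschitz (p k) := fun k => .of_mem_adjoin hG (hp k)
  have hint : ∀ s, MeasurableSet s → μ s < ∞ → ∀ i, IntegrableOn (lam i) s μ :=
    fun s _ hs i => Measure.integrableOn_of_bounded hs.ne (hmeas i).aestronglyMeasurable
      (ae_of_all _ fun x => hR i x)
  have hDint : ∀ s, MeasurableSet s → μ s < ∞ → ∀ i h, IsBddLipschitz h →
      IntegrableOn (fun x => lam i x * (Ds i).D h x) s μ := fun s hs hμs i h hh =>
    (hint s hs hμs i).mul_bdd ((Ds i).measurable_D h hh).aestronglyMeasurable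
      (ae_restrict_of_ae ((Ds i).bound h hh))
  refine ae_eq_zero_of_forall_setIntegral_eq_of_sigmaFinite
    (fun s hs hμs => integrable_finsetSum _ fun i _ => hDint s hs hμs i f hf) fun s hs hμs => ?_
  have htend : Tendsto (fun k => ∫ x in s, ∑ i, lam i x * (Ds i).D (p k) x ∂μ) atTop
      (𝓝 (∫ x in s, ∑ i, lam i x * (Ds i).D f x ∂μ)) := by
    rw [integral_finsetSum _ fun i _ => hDint s hs hμs i f hf]
    simp only [fun k => integral_finsetSum Finset.univ fun i _ => hDint s hs hμs i (p k) (hpL k)]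
    refine tendsto_finsetSum _ fun i _ => ?_
    have h := (Ds i).weakStar p f hpL hf hB hlim (s.indicator (lam i))
      ((integrable_indicator_iff hs).mpr (hint s hs hμs i))
    have hrw : ∀ h : X → ℝ, ∫ x, (Ds i).D h x * s.indicator (lam i) x ∂μ
        = ∫ x in s, lam i x * (Ds i).D h x ∂μ := fun h => by
      rw [← integral_indicator hs]
      congr 1 with x
      by_cases hx : x ∈ s <;> simp [hx, mul_comm]
    simpa only [hrw] using h
  refine tendsto_nhds_unique htend (tendsto_const_nhds.congr fun k => ?_)
  exact (integral_eq_zero_of_ae (ae_restrict_of_ae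
    (sum_mul_eq_zero_of_mem_adjoin Ds lam hG hzero (hp k)))).symm

end MDerivation

/-- For linearly independent derivations, measurable coefficients of a combination that vanishes on
a sequentially generating set are zero, bounded or not. -/
theorem LinIndepDer.ae_eq_zero {X : Type*} [PseudoMetricSpace X] [MeasurableSpace X]
    {μ : Measure X} [SigmaFinite μ] {n : ℕ} {Ds : Fin n → MDerivation X μ}
    (hind : LinIndepDer μ Ds) {G : Set (X → ℝ)} (hG : ∀ h ∈ G, IsBddLipschitz h)
    (hgen : SeqGenerates G) (lam : Fin n → X → ℝ) (hmeas : ∀ i, Measurable (lam i))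
    (hzero : ∀ h ∈ G, ∀ᵐ x ∂μ, ∑ i, lam i x * (Ds i).D h x = 0) (i : Fin n) :
    ∀ᵐ x ∂μ, lam i x = 0 := by
  have hpos : ∀ x, 0 < 1 + ∑ j, |lam j x| := fun x => by positivity
  set nu : Fin n → X → ℝ := fun i x => (1 + ∑ j, |lam j x|)⁻¹ * lam i x with hnu
  have hnum : ∀ i, Measurable (nu i) := fun i => by
    have := fun j => (hmeas j).norm
    simp only [Real.norm_eq_abs] at this
    exact ((Finset.measurable_sum _ fun j _ => this j).const_add 1).inv.mul (hmeas i)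
  have hnub : ∀ i x, |nu i x| ≤ 1 := fun i x => by
    rw [hnu, abs_mul, abs_of_pos (inv_pos.mpr (hpos x)), inv_mul_le_one₀ (hpos x)]
    have := Finset.single_le_sum (f := fun j => |lam j x|) (fun j _ => abs_nonneg _)
      (Finset.mem_univ i)
    linarith
  have hnuz : ∀ h ∈ G, ∀ᵐ x ∂μ, ∑ i, nu i x * (Ds i).D h x = 0 := fun h hh => by
    filter_upwards [hzero h hh] with x hx
    simp only [hnu, mul_assoc, ← Finset.mul_sum, hx, mul_zero]
  filter_upwards [hind nu hnum (fun i => ⟨1, ae_of_all _ (hnub i)⟩) (fun f hf =>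
    MDerivation.sum_mul_eq_zero_of_seqGenerates Ds nu hnum hnub hG hgen hnuz hf) i] with x hx
  exact (mul_eq_zero.mp hx).resolve_left (inv_pos.mpr (hpos x)).ne'

namespace Matrix

variable {n : ℕ}

/-- The characteristic polynomial of `G` with its coefficients shifted down by `m`,
evaluated at `G`. -/
def charpolyShift (G : Matrix (Fin n) (Fin n) ℝ) (m : ℕ) : Matrix (Fin n) (Fin n) ℝ :=
  ∑ k ∈ Finset.range (n + 1), G.charpoly.coeff (k + m) • G ^ k

theorem pow_mul_charpolyShift (G : Matrix (Fin n) (Fin n) ℝ) (m : ℕ)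
    (hm : ∀ j < m, G.charpoly.coeff j = 0) : G ^ m * G.charpolyShift m = 0 := by
  have hdeg : G.charpoly.natDegree < m + (n + 1) := by
    rw [charpoly_natDegree_eq_dim, Fintype.card_fin]; lia
  have hCH := G.aeval_self_charpoly
  rw [Polynomial.aeval_eq_sum_range' hdeg, Finset.sum_range_add,
    Finset.sum_eq_zero fun j hj => by rw [hm j (Finset.mem_range.mp hj), zero_smul],
    zero_add] at hCH
  rw [charpolyShift, Finset.mul_sum, ← hCH]
  exact Finset.sum_congr rfl fun k _ => by rw [mul_smul_comm, ← pow_add, add_comm k m]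

theorem det_ne_zero_of_charpolyShift_eq_zero (G : Matrix (Fin n) (Fin n) ℝ) (m : ℕ)
    (hm : G.charpoly.coeff m ≠ 0) (hB : G.charpolyShift m = 0) : G.det ≠ 0 := by
  intro hdet
  obtain ⟨v, hv, hGv⟩ := exists_mulVec_eq_zero_iff.mpr hdet
  have h : G.charpolyShift m *ᵥ v = G.charpoly.coeff m • v := by
    rw [charpolyShift, Finset.sum_range_succ', add_mulVec, sum_mulVec,
      Finset.sum_eq_zero fun k _ => by
        rw [smul_mulVec, pow_succ, ← mulVec_mulVec, hGv, mulVec_zero, smul_zero]]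
    simp [smul_mulVec]
  rw [hB, zero_mulVec] at h
  exact (smul_ne_zero hm hv) h.symm

theorem IsSymm.mul_eq_zero_of_pow_mul_eq_zero {G B : Matrix (Fin n) (Fin n) ℝ} (hG : G.IsSymm)
    (m : ℕ) (h : G ^ m * B = 0) : G * B = 0 := by
  induction m with
  | zero => rw [pow_zero, one_mul] at h; rw [h, mul_zero]
  | succ k ih =>
    rcases k with _ | k
    · simpa using h
    · refine ih ?_
      rw [← conjTranspose_mul_self_eq_zero, conjTranspose_eq_transpose_of_trivial, transpose_mul,
        transpose_pow, hG.eq]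
      calc Bᵀ * G ^ (k + 1) * (G ^ (k + 1) * B) = Bᵀ * G ^ k * (G ^ (k + 1 + 1) * B) := by
            rw [pow_succ' G (k + 1)]; nth_rw 1 [pow_succ G k]; simp only [Matrix.mul_assoc]
        _ = 0 := by rw [h, mul_zero]

theorem transpose_mul_charpolyShift_gram {M : ℕ} (A : Matrix (Fin n) (Fin M) ℝ) (m : ℕ)
    (hm : ∀ j < m, (A * Aᵀ).charpoly.coeff j = 0) : Aᵀ * (A * Aᵀ).charpolyShift m = 0 := by
  have hsymm : (A * Aᵀ).IsSymm := by rw [IsSymm, transpose_mul, transpose_transpose]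
  have hker := hsymm.mul_eq_zero_of_pow_mul_eq_zero m (pow_mul_charpolyShift _ m hm)
  generalize (A * Aᵀ).charpolyShift m = B at hker ⊢
  rw [← conjTranspose_eq_transpose_of_trivial] at hker ⊢
  exact (self_mul_conjTranspose_mul_eq_zero A B).mp hker

theorem linearIndependent_row_of_det_gram_ne_zero {M : ℕ} (A : Matrix (Fin n) (Fin M) ℝ)
    (h : (A * Aᵀ).det ≠ 0) : LinearIndependent ℝ A.row := by
  rw [← vecMul_injective_iff]
  refine Function.Injective.of_comp (f := fun w => w ᵥ* Aᵀ) ?_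
  simp only [Function.comp_def, vecMul_vecMul]
  exact vecMul_injective_of_isUnit ((isUnit_iff_isUnit_det _).mpr h.isUnit)

variable {X : Type*} [MeasurableSpace X] {G : X → Matrix (Fin n) (Fin n) ℝ}

theorem measurable_charpoly_coeff (hG : ∀ i j, Measurable fun x => G x i j) (k : ℕ) :
    Measurable fun x => (G x).charpoly.coeff k := by
  have h : ∀ x, (G x).charpoly.coeff k =
      MvPolynomial.eval (fun ij : Fin n × Fin n => G x ij.1 ij.2)
        ((charpoly.univ ℝ (Fin n)).coeff k) := fun x =>
    (charpoly.univ_coeff_eval₂Hom (Fin n) (RingHom.id ℝ) (fun ij => G x ij.1 ij.2) k).symm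
  simp only [h]
  exact (MvPolynomial.continuous_eval _).measurable.comp
    (measurable_pi_lambda _ fun ij => hG ij.1 ij.2)

theorem measurable_pow_apply (hG : ∀ i j, Measurable fun x => G x i j) (k : ℕ) (i j : Fin n) :
    Measurable fun x => (G x ^ k) i j := by
  induction k generalizing i j with
  | zero => simp only [pow_zero]; exact measurable_const
  | succ k ih =>
    simp only [pow_succ, mul_apply]
    exact Finset.measurable_sum _ fun l _ => (ih i l).mul (hG l j)

theorem measurable_charpolyShift (hG : ∀ i j, Measurable fun x => G x i j) (m : ℕ)
    (i j : Fin n) : Measurable fun x => (G x).charpolyShift m i j := by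
  simp only [charpolyShift, sum_apply, smul_apply, smul_eq_mul]
  exact Finset.measurable_sum _ fun k _ =>
    (measurable_charpoly_coeff hG _).mul (measurable_pow_apply hG k i j)

end Matrix

theorem stmt_12 {X : Type*} [MetricSpace X] [MeasurableSpace X] [BorelSpace X]
    (μ : Measure X) [SigmaFinite μ] (hμ : μ ≠ 0)
    {n M : ℕ} (Ds : Fin n → MDerivation X μ) (hind : LinIndepDer μ Ds)
    (g : Fin M → X → ℝ) (hg : ∀ j, IsBddLipschitz (g j))
    (hgen : SeqGenerates (Set.range g)) :
    (∀ᵐ x ∂μ, LinearIndependent ℝ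
      fun i : Fin n => (fun j : Fin M => (Ds i).D (g j) x : Fin M → ℝ)) ∧ n ≤ M := by
  have hG : ∀ h ∈ Set.range g, IsBddLipschitz h := by rintro _ ⟨j, rfl⟩; exact hg j
  obtain ⟨A, hA⟩ : ∃ A : X → Matrix (Fin n) (Fin M) ℝ, ∀ x i j, A x i j = (Ds i).D (g j) x :=
    ⟨fun x => Matrix.of fun i j => (Ds i).D (g j) x, fun _ _ _ => rfl⟩
  have hgram : ∀ i j, Measurable fun x => (A x * (A x).transpose) i j := fun i j => by
    simp only [Matrix.mul_apply, Matrix.transpose_apply, hA]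
    exact Finset.measurable_sum _ fun l _ =>
      ((Ds i).measurable_D _ (hg l)).mul ((Ds j).measurable_D _ (hg l))
  have hzero : ∀ m, ∀ᵐ x ∂μ, (∀ j < m, (A x * (A x).transpose).charpoly.coeff j = 0) →
      (A x * (A x).transpose).charpolyShift m = 0 := by
    intro m
    set S : Set X := {x | ∀ j < m, (A x * (A x).transpose).charpoly.coeff j = 0} with hS
    have hSm : MeasurableSet S := by
      simp only [hS, ofPred_forall]
      exact .iInter fun j => .iInter fun _ =>
        Matrix.measurable_charpoly_coeff hgram j (measurableSet_singleton 0)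
    have hcol : ∀ i k, ∀ᵐ x ∂μ,
        S.indicator (fun x => (A x * (A x).transpose).charpolyShift m i k) x = 0 := by
      intro i k
      refine hind.ae_eq_zero hG hgen
        (fun i => S.indicator fun x => (A x * (A x).transpose).charpolyShift m i k)
        (fun i => (Matrix.measurable_charpolyShift hgram m i k).indicator hSm) ?_ i
      rintro _ ⟨j, rfl⟩
      refine ae_of_all _ fun x => ?_
      by_cases hx : x ∈ S
      · have hjk := congrFun (congrFun (Matrix.transpose_mul_charpolyShift_gram (A x) m hx) j) k
        rw [Matrix.mul_apply] at hjk
        simpa only [indicator_of_mem hx, Matrix.transpose_apply, hA, Matrix.zero_apply,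
          mul_comm] using hjk
      · simp [hx]
    filter_upwards [ae_all_iff.mpr fun i => ae_all_iff.mpr (hcol i)] with x hx hxS
    ext i k
    simpa [show x ∈ S from hxS] using hx i k
  have hli : ∀ᵐ x ∂μ, LinearIndependent ℝ
      fun i : Fin n => (fun j : Fin M => (Ds i).D (g j) x : Fin M → ℝ) := by
    filter_upwards [ae_all_iff.mpr hzero] with x hx
    have hne : ∃ m, (A x * (A x).transpose).charpoly.coeff m ≠ 0 := by
      by_contra! h
      exact (Matrix.charpoly_monic _).ne_zero (Polynomial.ext h)
    classical
    have hdet := Matrix.det_ne_zero_of_charpolyShift_eq_zero _ _ (Nat.find_spec hne)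
      (hx _ fun j hj => not_not.mp (Nat.find_min hne hj))
    convert Matrix.linearIndependent_row_of_det_gram_ne_zero (A x) hdet using 3
    exact (hA _ _ _).symm
  refine ⟨hli, ?_⟩
  have : (ae μ).NeBot := ae_neBot.mpr hμ
  obtain ⟨x, hx⟩ := hli.exists
  simpa using hx.fintype_card_le_finrank
end
end
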